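/- arXiv:1912.06043 — 2 statements merged into one kernel-verified Lean document; each statement's English description precedes it below -/
import Mathlib

section
/- Every generalized k-arc in the projective plane P²(F₄) over the field with 4 elements satisfies k ≤ 7; that is, there is no generalized 8-arc in P²(F₄), and hence m_g(2,4) = 7. -/
/-- The projective plane over `F`: points are 1-dimensional subspaces of `F³`. -/
abbrev P2 (F : Type*) [Field F] := Projectivization F (Fin 3 → F)

/-- A conic in `P²(F)`: the vanishing set of a nonzero homogeneous quadratic form
in three variables (possibly reducible). -/
def IsConic {F : Type*} [Field F] (C : Set (P2 F)) : Prop :=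
  ∃ Q : MvPolynomial (Fin 3) F, Q ≠ 0 ∧ Q.IsHomogeneous 2 ∧
    C = {p : P2 F | MvPolynomial.eval p.rep Q = 0}

/-- A line in `P²(F)`: the vanishing set of a nonzero linear form in three variables. -/
def IsLine {F : Type*} [Field F] (L : Set (P2 F)) : Prop :=
  ∃ φ : MvPolynomial (Fin 3) F, φ ≠ 0 ∧ φ.IsHomogeneous 1 ∧
    L = {p : P2 F | MvPolynomial.eval p.rep φ = 0}

/-- A generalized arc: no conic contains 6 of its points. -/
def IsGenArc {F : Type*} [Field F] (K : Set (P2 F)) : Prop :=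
  ∀ C : Set (P2 F), IsConic C → (K ∩ C).ncard ≤ 5

/-- An arc: no line contains 3 of its points. -/
def IsArc {F : Type*} [Field F] (K : Set (P2 F)) : Prop :=
  ∀ L : Set (P2 F), IsLine L → (K ∩ L).ncard ≤ 2

open MvPolynomial in
/-- The ternary quadratic form with coefficient vector `a`. -/
noncomputable def ternaryForm {F : Type*} [Field F] (a : Fin 6 → F) : MvPolynomial (Fin 3) F :=
  C (a 0) * X 0 ^ 2 + C (a 1) * X 1 ^ 2 + C (a 2) * X 2 ^ 2 +
    C (a 3) * (X 0 * X 1) + C (a 4) * (X 0 * X 2) + C (a 5) * (X 1 * X 2)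

section TernaryForm

variable {F : Type*} [Field F]

theorem eval_ternaryForm (a : Fin 6 → F) (x : Fin 3 → F) :
    MvPolynomial.eval x (ternaryForm a) =
      a 0 * x 0 ^ 2 + a 1 * x 1 ^ 2 + a 2 * x 2 ^ 2 +
        a 3 * (x 0 * x 1) + a 4 * (x 0 * x 2) + a 5 * (x 1 * x 2) := by
  simp [ternaryForm]

theorem isHomogeneous_ternaryForm (a : Fin 6 → F) : (ternaryForm a).IsHomogeneous 2 := by
  have hX : ∀ i : Fin 3, (MvPolynomial.X i : MvPolynomial (Fin 3) F).IsHomogeneous 1 :=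
    fun i => MvPolynomial.isHomogeneous_X F i
  have sq : ∀ (c : F) (i : Fin 3),
      (MvPolynomial.C c * MvPolynomial.X i ^ 2 : MvPolynomial (Fin 3) F).IsHomogeneous 2 :=
    fun c i => ((hX i).pow 2).C_mul c
  have mixed : ∀ (c : F) (i j : Fin 3),
      (MvPolynomial.C c * (MvPolynomial.X i * MvPolynomial.X j) :
        MvPolynomial (Fin 3) F).IsHomogeneous 2 :=
    fun c i j => ((hX i).mul (hX j)).C_mul c
  exact (((((sq _ _).add (sq _ _)).add (sq _ _)).add (mixed _ _ _)).add (mixed _ _ _)).add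
    (mixed _ _ _)

theorem ternaryForm_add (a b : Fin 6 → F) :
    ternaryForm (a + b) = ternaryForm a + ternaryForm b := by
  simp only [ternaryForm, Pi.add_apply, map_add]
  ring

/-- Every homogeneous polynomial of degree two in three variables is a `ternaryForm`. -/
theorem exists_eq_ternaryForm {Q : MvPolynomial (Fin 3) F} (hQ : Q.IsHomogeneous 2) :
    ∃ a, Q = ternaryForm a := by
  rw [Q.as_sum]
  refine Finset.sum_induction _ (fun P => ∃ a, P = ternaryForm a) ?_ ?_ ?_
  · rintro _ _ ⟨a, rfl⟩ ⟨b, rfl⟩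
    exact ⟨a + b, (ternaryForm_add a b).symm⟩
  · exact ⟨0, by simp [ternaryForm]⟩
  · intro m hm
    have hdeg : m 0 + m 1 + m 2 = 2 := by
      have h := hQ (MvPolynomial.mem_support_iff.mp hm)
      rw [Finsupp.weight_apply, Finsupp.sum_fintype _ _ (by simp)] at h
      simpa [Fin.sum_univ_three] using h
    generalize MvPolynomial.coeff m Q = c
    have hmon : MvPolynomial.monomial m c = MvPolynomial.C c *
        (MvPolynomial.X 0 ^ m 0 * MvPolynomial.X 1 ^ m 1 * MvPolynomial.X 2 ^ m 2) := by
      rw [MvPolynomial.monomial_eq, Finsupp.prod_fintype _ _ (by simp), Fin.prod_univ_three]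
    rw [hmon]
    have hcases : (m 0 = 2 ∧ m 1 = 0 ∧ m 2 = 0) ∨ (m 0 = 0 ∧ m 1 = 2 ∧ m 2 = 0) ∨
        (m 0 = 0 ∧ m 1 = 0 ∧ m 2 = 2) ∨ (m 0 = 1 ∧ m 1 = 1 ∧ m 2 = 0) ∨
        (m 0 = 1 ∧ m 1 = 0 ∧ m 2 = 1) ∨ (m 0 = 0 ∧ m 1 = 1 ∧ m 2 = 1) := by omega
    rcases hcases with ⟨h0, h1, h2⟩ | ⟨h0, h1, h2⟩ | ⟨h0, h1, h2⟩ | ⟨h0, h1, h2⟩ |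
      ⟨h0, h1, h2⟩ | ⟨h0, h1, h2⟩ <;> rw [h0, h1, h2]
    · exact ⟨![c, 0, 0, 0, 0, 0], by simp [ternaryForm]⟩
    · exact ⟨![0, c, 0, 0, 0, 0], by simp [ternaryForm]⟩
    · exact ⟨![0, 0, c, 0, 0, 0], by simp [ternaryForm]⟩
    · exact ⟨![0, 0, 0, c, 0, 0], by simp [ternaryForm]⟩
    · exact ⟨![0, 0, 0, 0, c, 0], by simp [ternaryForm]⟩
    · exact ⟨![0, 0, 0, 0, 0, c], by simp [ternaryForm]⟩

/-- The vector in `F³` with entries `0` and `1` supported on `s`. -/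
def indicatorVec (F : Type*) [Field F] (s : Finset (Fin 3)) : Fin 3 → F :=
  fun i => if i ∈ s then 1 else 0

theorem eq_zero_of_eval_indicatorVec {a : Fin 6 → F}
    (h : ∀ s : Finset (Fin 3), s.Nonempty →
      MvPolynomial.eval (indicatorVec F s) (ternaryForm a) = 0) : a = 0 := by
  have h0 := h {0} (by decide)
  have h1 := h {1} (by decide)
  have h2 := h {2} (by decide)
  have h3 := h {0, 1} (by decide)
  have h4 := h {0, 2} (by decide)
  have h5 := h {1, 2} (by decide)
  simp [eval_ternaryForm, indicatorVec] at h0 h1 h2 h3 h4 h5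
  ext i
  fin_cases i <;> simp_all

theorem ternaryForm_ne_zero {a : Fin 6 → F} (ha : a ≠ 0) : ternaryForm a ≠ 0 := by
  intro h
  exact ha (eq_zero_of_eval_indicatorVec fun s _ => by simp [h])

theorem sum_eval_indicatorVec [CharP F 2] (a : Fin 6 → F) :
    ∑ s ∈ (Finset.univ : Finset (Finset (Fin 3))),
      MvPolynomial.eval (indicatorVec F s) (ternaryForm a) = 0 := by
  have huniv : (Finset.univ : Finset (Finset (Fin 3))) =
      {∅, {0}, {1}, {2}, {0, 1}, {0, 2}, {1, 2}, {0, 1, 2}} := by decide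
  have two : (2 : F) = 0 := CharTwo.two_eq_zero
  rw [huniv]
  repeat rw [Finset.sum_insert (by decide)]
  rw [Finset.sum_singleton]
  simp [eval_ternaryForm, indicatorVec]
  linear_combination (2 * (a 0 + a 1 + a 2) + a 3 + a 4 + a 5) * two

theorem eval_ternaryForm_smul (a : Fin 6 → F) (c : F) (x : Fin 3 → F) :
    MvPolynomial.eval (c • x) (ternaryForm a) =
      c ^ 2 * MvPolynomial.eval x (ternaryForm a) := by
  simp only [eval_ternaryForm, Pi.smul_apply, smul_eq_mul]
  ring

theorem eval_rep_mk_ternaryForm (a : Fin 6 → F) {x : Fin 3 → F} (hx : x ≠ 0) :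
    MvPolynomial.eval (Projectivization.mk F x hx).rep (ternaryForm a) = 0 ↔
      MvPolynomial.eval x (ternaryForm a) = 0 := by
  obtain ⟨c, hc⟩ := Projectivization.exists_smul_eq_mk_rep F x hx
  rw [← hc, Units.smul_def, eval_ternaryForm_smul]
  simp

end TernaryForm

section Fano

variable (F : Type*) [Field F]

theorem indicatorVec_ne_zero {s : Finset (Fin 3)} (hs : s.Nonempty) : indicatorVec F s ≠ 0 := by
  obtain ⟨i, hi⟩ := hs
  intro h
  simpa [indicatorVec, hi] using congrFun h i

/-- The points of the Fano plane, embedded as the points with coordinates `0` and `1`. -/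
def fanoPoint (s : {s : Finset (Fin 3) // s.Nonempty}) : P2 F :=
  Projectivization.mk F (indicatorVec F s.1) (indicatorVec_ne_zero F s.2)

theorem fanoPoint_injective : Function.Injective (fanoPoint F) := by
  rintro ⟨s, hs⟩ ⟨t, ht⟩ h
  obtain ⟨c, hc⟩ := (Projectivization.mk_eq_mk_iff F _ _ _ _).mp h
  ext i
  have := congrFun hc i
  by_cases his : i ∈ s <;> by_cases hit : i ∈ t <;>
    simp_all [indicatorVec, Units.smul_def]

theorem ncard_range_fanoPoint : (Set.range (fanoPoint F)).ncard = 7 := by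
  rw [← Set.image_univ, Set.ncard_image_of_injective _ (fanoPoint_injective F), Set.ncard_univ,
    Nat.card_eq_fintype_card]
  decide

/-- In characteristic two the Fano plane is a generalized arc. -/
theorem isGenArc_range_fanoPoint [CharP F 2] : IsGenArc (Set.range (fanoPoint F)) := by
  rintro _ ⟨Q, hQ0, hQ, rfl⟩
  obtain ⟨a, rfl⟩ := exists_eq_ternaryForm hQ
  by_contra! hcard
  have hfin : (Set.range (fanoPoint F)).Finite := Set.finite_range _
  have hdiff := Set.ncard_inter_add_ncard_sdiff_eq_ncard (Set.range (fanoPoint F))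
    {p : P2 F | MvPolynomial.eval p.rep (ternaryForm a) = 0} hfin
  rw [ncard_range_fanoPoint] at hdiff
  have hone := (Set.ncard_le_one hfin.sdiff).mp (show (Set.range (fanoPoint F) \
    {p : P2 F | MvPolynomial.eval p.rep (ternaryForm a) = 0}).ncard ≤ 1 by omega)
  have hsub : ∀ s t : Finset (Fin 3), s.Nonempty → t.Nonempty →
      MvPolynomial.eval (indicatorVec F s) (ternaryForm a) ≠ 0 →
      MvPolynomial.eval (indicatorVec F t) (ternaryForm a) ≠ 0 → s = t := by
    intro s t hs ht hs0 ht0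
    have := hone (fanoPoint F ⟨s, hs⟩)
      ⟨⟨_, rfl⟩, fun h => hs0 ((eval_rep_mk_ternaryForm a _).mp h)⟩ (fanoPoint F ⟨t, ht⟩)
      ⟨⟨_, rfl⟩, fun h => ht0 ((eval_rep_mk_ternaryForm a _).mp h)⟩
    exact congrArg Subtype.val (fanoPoint_injective F this)
  have hzero : a = 0 := by
    refine eq_zero_of_eval_indicatorVec fun s hs => ?_
    by_contra hs0
    refine hs0 ?_
    rw [← sum_eval_indicatorVec a]
    symm
    refine Finset.sum_eq_single s (fun t _ hts => ?_) fun h => absurd (Finset.mem_univ s) h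
    rcases t.eq_empty_or_nonempty with rfl | ht
    · simp [eval_ternaryForm, indicatorVec]
    · by_contra ht0
      exact hts (hsub t s ht hs ht0 hs0)
  exact hQ0 (by simp [hzero, ternaryForm])

end Fano

/-- The bound on the length of an MDS code of codimension two: among `dim W + 2 > |F| + 1`
functionals on `W`, some `dim W` have a common nonzero zero. -/
theorem exists_ne_zero_finrank_le_card_zeros {F W ι : Type*} [Field F] [Fintype F]
    [AddCommGroup W] [Module F W] [FiniteDimensional F W] [Fintype ι]
    (e : ι → Module.Dual F W) (hι : Fintype.card ι = Module.finrank F W + 2)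
    (hF : Fintype.card F + 1 < Fintype.card ι) :
    ∃ w : W, w ≠ 0 ∧ Module.finrank F W ≤ {i | e i w = 0}.ncard := by
  classical
  by_contra! H
  have relation_eq_zero : ∀ (c : ι → F) (j k : ι), j ≠ k → (∀ w, ∑ i, c i * e i w = 0) →
      c j = 0 → c k = 0 → c = 0 := by
    intro c j k hjk hc hj hk
    by_contra hne
    obtain ⟨l, hl⟩ := Function.ne_iff.mp hne
    have hlj : l ≠ j := fun h => hl (h ▸ hj)
    have hlk : l ≠ k := fun h => hl (h ▸ hk)
    have hcard : ({j, k, l} : Finset ι).card = 3 := by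
      simp [hjk, hlj.symm, hlk.symm]
    have hthree := hcard ▸ Finset.card_le_univ ({j, k, l} : Finset ι)
    let T : W →ₗ[F] ((({j, k, l} : Finset ι)ᶜ : Finset ι) → F) := LinearMap.pi fun i => e i
    obtain ⟨w, hw, hw0⟩ := Submodule.exists_mem_ne_zero_of_ne_bot
      (LinearMap.ker_ne_bot_of_finrank_lt (f := T) (by
        rw [Module.finrank_fintype_fun_eq_card, Fintype.card_coe, Finset.card_compl]
        omega))
    have hz : ∀ i, i ≠ j → i ≠ k → i ≠ l → e i w = 0 := fun i h1 h2 h3 =>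
      congrFun (LinearMap.mem_ker.mp hw) ⟨i, by simp [h1, h2, h3]⟩
    have hlw : e l w = 0 := by
      have hsum := hc w
      rw [Finset.sum_eq_single l] at hsum
      · exact (mul_eq_zero.mp hsum).resolve_left hl
      · intro i _ hil
        by_cases hij : i = j
        · simp [hij, hj]
        by_cases hik : i = k
        · simp [hik, hk]
        simp [hz i hij hik hil]
      · simp
    have hsub : ((({j, k} : Finset ι)ᶜ : Finset ι) : Set ι) ⊆ {i | e i w = 0} := by
      intro i hi
      simp only [Finset.coe_compl, Finset.coe_insert, Finset.coe_singleton, Set.mem_compl_iff,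
        Set.mem_insert_iff, Set.mem_singleton_iff, not_or] at hi
      by_cases hil : i = l
      · exact hil ▸ hlw
      · exact hz i hi.1 hi.2 hil
    have hle := Set.ncard_le_ncard hsub (Set.toFinite _)
    rw [Set.ncard_coe_finset, Finset.card_compl, Finset.card_pair hjk] at hle
    have := H w hw0
    omega
  have exists_relation : ∀ j : ι, ∃ c : ι → F, (∀ w, ∑ i, c i * e i w = 0) ∧ c j = 0 ∧
      ∀ i, i ≠ j → c i ≠ 0 := by
    intro j
    let T : (ι → F) →ₗ[F] (Module.Dual F W × F) :=
      (Fintype.linearCombination F e).prod (LinearMap.proj j)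
    obtain ⟨c, hc, hc0⟩ := Submodule.exists_mem_ne_zero_of_ne_bot
      (LinearMap.ker_ne_bot_of_finrank_lt (f := T) (by
        rw [Module.finrank_fintype_fun_eq_card, Module.finrank_prod, Subspace.dual_finrank_eq,
          Module.finrank_self]
        omega))
    have hc' := Prod.mk.inj (LinearMap.mem_ker.mp hc)
    have hlin : Fintype.linearCombination F e c = 0 := hc'.1
    have hrel : ∀ w, ∑ i, c i * e i w = 0 := fun w => by
      simpa [Fintype.linearCombination_apply] using LinearMap.congr_fun hlin w
    exact ⟨c, hrel, hc'.2, fun i hij hi =>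
      hc0 (relation_eq_zero c i j hij hrel hi hc'.2)⟩
  have : Nontrivial ι := Fintype.one_lt_card_iff_nontrivial.mp (by omega)
  obtain ⟨x, y, hxy⟩ := exists_pair_ne ι
  obtain ⟨c, hc, hcx, hcne⟩ := exists_relation x
  obtain ⟨d, hd, -, hdne⟩ := exists_relation y
  obtain ⟨j, k, hjk, hratio⟩ := Fintype.exists_ne_map_eq_of_card_lt
    (fun i : {i // i ≠ x} => d i / c i) (by
      rw [Fintype.card_subtype_compl, Fintype.card_subtype_eq]
      omega)
  have hj : d j / c j * c j = d j := div_mul_cancel₀ _ (hcne j j.2)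
  have hk : d k / c k * c k = d k := div_mul_cancel₀ _ (hcne k k.2)
  have hzero := relation_eq_zero (d - (d j / c j) • c) j k (Subtype.coe_injective.ne hjk)
    (fun w => by
      simp only [Pi.sub_apply, Pi.smul_apply, smul_eq_mul, mul_assoc, sub_mul,
        Finset.sum_sub_distrib, ← Finset.mul_sum, hc, hd, mul_zero, sub_zero])
    (by simp [hj]) (by simp only [Pi.sub_apply, Pi.smul_apply, smul_eq_mul, hratio, hk, sub_self])
  have := congrFun hzero x
  simp [hcx] at this
  exact hdne x hxy this

/-- Evaluation of ternary quadratic forms at `x`, as a functional on coefficient vectors. -/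
def ternaryEval {F : Type*} [Field F] (x : Fin 3 → F) : Module.Dual F (Fin 6 → F) :=
  Fintype.linearCombination F ![x 0 ^ 2, x 1 ^ 2, x 2 ^ 2, x 0 * x 1, x 0 * x 2, x 1 * x 2]

theorem ternaryEval_apply {F : Type*} [Field F] (x : Fin 3 → F) (a : Fin 6 → F) :
    ternaryEval x a = MvPolynomial.eval x (ternaryForm a) := by
  simp [ternaryEval, Fintype.linearCombination_apply, Fin.sum_univ_six, eval_ternaryForm]

theorem IsGenArc.ncard_le_seven {F : Type*} [Field F] [Fintype F] (hF : Fintype.card F ≤ 6)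
    {K : Set (P2 F)} (hK : IsGenArc K) : K.ncard ≤ 7 := by
  by_contra! hlt
  obtain ⟨S, hSK, hS⟩ := Set.exists_subset_card_eq (show 8 ≤ K.ncard from hlt)
  have : Finite S := Set.finite_of_ncard_pos (by omega)
  have : Fintype S := Fintype.ofFinite S
  have hScard : Fintype.card S = 8 := by
    rw [← Nat.card_eq_fintype_card, Nat.card_coe_set_eq, hS]
  obtain ⟨a, ha, hcard⟩ := exists_ne_zero_finrank_le_card_zeros
    (fun p : S => ternaryEval p.1.rep) (by simp [hScard]) (by omega)
  rw [Module.finrank_fin_fun] at hcard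
  have hC := hK _ ⟨_, ternaryForm_ne_zero ha, isHomogeneous_ternaryForm a, rfl⟩
  have hle : (Subtype.val '' {p : S | ternaryEval p.1.rep a = 0}).ncard ≤
      (K ∩ {p : P2 F | MvPolynomial.eval p.rep (ternaryForm a) = 0}).ncard := by
    refine Set.ncard_le_ncard ?_ ((Set.finite_of_ncard_pos (by omega)).inter_of_left _)
    rintro _ ⟨p, hp, rfl⟩
    exact ⟨hSK p.2, (ternaryEval_apply _ _).symm.trans hp⟩
  rw [Set.ncard_image_of_injective _ Subtype.val_injective] at hle
  omega

/-- every generalized `k`-arc in `P²(F₄)` satisfies `k ≤ 7`; there is no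
generalized 8-arc, and `m_g(2,4) = 7`. -/
theorem stmt6 {F : Type*} [Field F] [Fintype F] (hF : Fintype.card F = 4) :
    (∀ (k : ℕ) (K : Set (P2 F)), K.ncard = k → IsGenArc K → k ≤ 7) ∧
    (¬ ∃ K : Set (P2 F), K.ncard = 8 ∧ IsGenArc K) ∧
    IsGreatest {k : ℕ | ∃ K : Set (P2 F), K.ncard = k ∧ IsGenArc K} 7 := by
  have bound : ∀ (k : ℕ) (K : Set (P2 F)), K.ncard = k → IsGenArc K → k ≤ 7 :=
    fun _ _ hk hK => hk ▸ hK.ncard_le_seven (by omega)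
  have : CharP F 2 := by
    have : Fact (Nat.Prime 2) := ⟨Nat.prime_two⟩
    exact charP_of_card_eq_prime_pow (f := 2) (by rw [hF]; norm_num)
  refine ⟨bound, ?_, ⟨_, ncard_range_fanoPoint F, isGenArc_range_fanoPoint F⟩, ?_⟩
  · rintro ⟨K, hcard, hK⟩
    exact absurd (bound 8 K hcard hK) (by norm_num)
  · rintro k ⟨K, hcard, hK⟩
    exact bound k K hcard hK
end

section
/- In the projective plane P²(F₅) over the field with 5 elements, the set of 7 points {[1:0:0], [0:1:0], [0:0:1], [1:1:1], [1:0:1], [1:1:0], [0:1:1]} is a generalized 7-arc, i.e. no conic of P²(F₅) contains 6 of these points. -/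
instance : Fact (Nat.Prime 5) := ⟨by norm_num⟩

theorem MvPolynomial.IsHomogeneous.sum_eq_of_coeff_ne_zero {F : Type*} [Field F]
    {Q : MvPolynomial (Fin 3) F} {n : ℕ} (hQ : Q.IsHomogeneous n) {d : Fin 3 →₀ ℕ}
    (hd : Q.coeff d ≠ 0) : ∑ i, d i = n := by
  rw [← Finsupp.degree_eq_sum, Finsupp.degree_eq_weight_one]
  exact hQ hd

open MvPolynomial in
theorem MvPolynomial.IsHomogeneous.eval_mk_rep_eq_zero_iff {F : Type*} [Field F]
    {Q : MvPolynomial (Fin 3) F} {n : ℕ} (hQ : Q.IsHomogeneous n) (v : Fin 3 → F) (hv : v ≠ 0) :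
    eval (Projectivization.mk F v hv).rep Q = 0 ↔ eval v Q = 0 := by
  obtain ⟨a, ha⟩ := Projectivization.exists_smul_eq_mk_rep F v hv
  have h : eval (a • v) Q = (a : F) ^ n * eval v Q := by
    rw [eval_eq', eval_eq', Finset.mul_sum]
    refine Finset.sum_congr rfl fun d hd => ?_
    have hdeg : ∑ i, d i = n := hQ.sum_eq_of_coeff_ne_zero (mem_support_iff.1 hd)
    simp only [Pi.smul_apply, Units.smul_def, smul_eq_mul, mul_pow, Finset.prod_mul_distrib,
      Finset.prod_pow_eq_pow_sum, hdeg]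
    ring
  rw [← ha, h]
  simp

/-- The coefficient of `Q` at the monomial with the given exponents. -/
noncomputable def ternaryCoeff {F : Type*} [Field F] (Q : MvPolynomial (Fin 3) F) (i j k : ℕ) : F :=
  Q.coeff (Finsupp.equivFunOnFinite.symm ![i, j, k])

open MvPolynomial in
theorem eval_ternary_quadratic {F : Type*} [Field F]
    {Q : MvPolynomial (Fin 3) F} (hQ : Q.IsHomogeneous 2) (v : Fin 3 → F) :
    eval v Q = ternaryCoeff Q 2 0 0 * v 0 ^ 2 + ternaryCoeff Q 0 2 0 * v 1 ^ 2 +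
      ternaryCoeff Q 0 0 2 * v 2 ^ 2 + ternaryCoeff Q 1 1 0 * (v 0 * v 1) +
      ternaryCoeff Q 1 0 1 * (v 0 * v 2) + ternaryCoeff Q 0 1 1 * (v 1 * v 2) := by
  have hsub : Q.support ⊆ (Finset.Nat.antidiagonalTuple 3 2).map
      Finsupp.equivFunOnFinite.symm.toEmbedding := by
    intro d hd
    refine Finset.mem_map.2 ⟨d, Finset.Nat.mem_antidiagonalTuple.2 ?_, by simp⟩
    exact hQ.sum_eq_of_coeff_ne_zero (mem_support_iff.1 hd)
  have hl : Finset.Nat.antidiagonalTuple 3 2 =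
      {![2, 0, 0], ![0, 2, 0], ![0, 0, 2], ![1, 1, 0], ![1, 0, 1], ![0, 1, 1]} := by decide
  rw [eval_eq', Finset.sum_subset hsub, Finset.sum_map, hl]
  · repeat rw [Finset.sum_insert (by decide)]
    simp [ternaryCoeff, Fin.prod_univ_three]
    ring
  · intro d _ hd
    simp [notMem_support_iff.1 hd]

open MvPolynomial in
theorem eq_zero_of_ternaryCoeff_eq_zero {F : Type*} [Field F]
    {Q : MvPolynomial (Fin 3) F} (hQ : Q.IsHomogeneous 2)
    (h₁ : ternaryCoeff Q 2 0 0 = 0) (h₂ : ternaryCoeff Q 0 2 0 = 0)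
    (h₃ : ternaryCoeff Q 0 0 2 = 0) (h₄ : ternaryCoeff Q 1 1 0 = 0)
    (h₅ : ternaryCoeff Q 1 0 1 = 0) (h₆ : ternaryCoeff Q 0 1 1 = 0) : Q = 0 := by
  ext d
  rw [coeff_zero]
  by_contra hd
  have hl : (d : Fin 3 → ℕ) ∈ Finset.Nat.antidiagonalTuple 3 2 :=
    Finset.Nat.mem_antidiagonalTuple.2 (hQ.sum_eq_of_coeff_ne_zero hd)
  rw [show Finset.Nat.antidiagonalTuple 3 2 =
      {![2, 0, 0], ![0, 2, 0], ![0, 0, 2], ![1, 1, 0], ![1, 0, 1], ![0, 1, 1]} by decide] at hl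
  have hd' : d = Finsupp.equivFunOnFinite.symm (d : Fin 3 → ℕ) := by simp
  simp only [Finset.mem_insert, Finset.mem_singleton] at hl
  rw [hd'] at hd
  rcases hl with h | h | h | h | h | h <;> rw [h] at hd <;> exact hd (by assumption)

/-- Vectors spanning the seven points with coordinates in `{0, 1}`. -/
def binaryVec : Fin 7 → Fin 3 → ZMod 5 :=
  ![![1, 0, 0], ![0, 1, 0], ![0, 0, 1], ![1, 1, 1], ![1, 0, 1], ![1, 1, 0], ![0, 1, 1]]

theorem binaryVec_ne_zero (i : Fin 7) : binaryVec i ≠ 0 := by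
  revert i; decide

/-- The seven points of `P²(F₅)` with coordinates in `{0, 1}`. -/
def binaryPoint (i : Fin 7) : P2 (ZMod 5) :=
  Projectivization.mk (ZMod 5) (binaryVec i) (binaryVec_ne_zero i)

set_option maxRecDepth 10000 in
theorem binaryPoint_injective : Function.Injective binaryPoint := by
  intro i j h
  rw [binaryPoint, binaryPoint, Projectivization.mk_eq_mk_iff'] at h
  revert i j
  decide

theorem ncard_range_binaryPoint : (Set.range binaryPoint).ncard = 7 := by
  rw [Set.ncard_range_of_injective binaryPoint_injective, Nat.card_fin]

open MvPolynomial in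
theorem exists_pair_eval_binaryVec_ne_zero {Q : MvPolynomial (Fin 3) (ZMod 5)}
    (hQ : Q.IsHomogeneous 2) (hQ0 : Q ≠ 0) :
    ∃ i j, i ≠ j ∧ eval (binaryVec i) Q ≠ 0 ∧ eval (binaryVec j) Q ≠ 0 := by
  by_contra! h
  have hrel : eval (binaryVec 0) Q + eval (binaryVec 1) Q + eval (binaryVec 2) Q
      + eval (binaryVec 3) Q =
      eval (binaryVec 4) Q + eval (binaryVec 5) Q + eval (binaryVec 6) Q := by
    simp only [eval_ternary_quadratic hQ]
    simp [binaryVec]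
    ring
  have hall : ∀ i, eval (binaryVec i) Q = 0 := by
    intro i
    by_contra hi
    have hj : ∀ j, i ≠ j → eval (binaryVec j) Q = 0 := fun j hij => h i j hij hi
    apply hi
    fin_cases i <;> simp_all [Fin.forall_fin_succ]
  simp only [eval_ternary_quadratic hQ] at hall
  simp [Fin.forall_fin_succ, binaryVec] at hall
  obtain ⟨h₁, h₂, h₃, -, h₅, h₄, h₆⟩ := hall
  simp only [h₁, h₂, h₃, zero_add] at h₄ h₅ h₆
  exact hQ0 (eq_zero_of_ternaryCoeff_eq_zero hQ h₁ h₂ h₃ h₄ h₅ h₆)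

theorem isGenArc_range_binaryPoint : IsGenArc (Set.range binaryPoint) := by
  rintro C ⟨Q, hQ0, hQ, rfl⟩
  obtain ⟨i, j, hij, hi, hj⟩ := exists_pair_eval_binaryVec_ne_zero hQ hQ0
  rw [Ne, ← hQ.eval_mk_rep_eq_zero_iff _ (binaryVec_ne_zero _)] at hi hj
  set C := {p : P2 (ZMod 5) | MvPolynomial.eval p.rep Q = 0}
  have hpair : ({binaryPoint i, binaryPoint j} : Set _) ⊆ Set.range binaryPoint \ C := by
    rintro _ (rfl | rfl)
    exacts [⟨⟨i, rfl⟩, hi⟩, ⟨⟨j, rfl⟩, hj⟩]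
  have hcard := Set.ncard_le_ncard hpair ((Set.finite_range _).sdiff)
  rw [Set.ncard_pair (binaryPoint_injective.ne hij)] at hcard
  have := Set.ncard_inter_add_ncard_sdiff_eq_ncard (Set.range binaryPoint) C (Set.finite_range _)
  rw [ncard_range_binaryPoint] at this
  omega

theorem range_binaryPoint : Set.range binaryPoint =
    {Projectivization.mk (ZMod 5) ![1, 0, 0] (by decide),
      Projectivization.mk (ZMod 5) ![0, 1, 0] (by decide),
      Projectivization.mk (ZMod 5) ![0, 0, 1] (by decide),
      Projectivization.mk (ZMod 5) ![1, 1, 1] (by decide),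
      Projectivization.mk (ZMod 5) ![1, 0, 1] (by decide),
      Projectivization.mk (ZMod 5) ![1, 1, 0] (by decide),
      Projectivization.mk (ZMod 5) ![0, 1, 1] (by decide)} := by
  ext p
  simp [Fin.exists_fin_succ, binaryPoint, binaryVec, eq_comm]

/-- in `P²(F₅)` the set
`{[1:0:0], [0:1:0], [0:0:1], [1:1:1], [1:0:1], [1:1:0], [0:1:1]}`
is a generalized 7-arc. -/
theorem stmt7 :
    ({Projectivization.mk (ZMod 5) ![1, 0, 0] (by decide),
      Projectivization.mk (ZMod 5) ![0, 1, 0] (by decide),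
      Projectivization.mk (ZMod 5) ![0, 0, 1] (by decide),
      Projectivization.mk (ZMod 5) ![1, 1, 1] (by decide),
      Projectivization.mk (ZMod 5) ![1, 0, 1] (by decide),
      Projectivization.mk (ZMod 5) ![1, 1, 0] (by decide),
      Projectivization.mk (ZMod 5) ![0, 1, 1] (by decide)} : Set (P2 (ZMod 5))).ncard = 7 ∧
    IsGenArc ({Projectivization.mk (ZMod 5) ![1, 0, 0] (by decide),
      Projectivization.mk (ZMod 5) ![0, 1, 0] (by decide),
      Projectivization.mk (ZMod 5) ![0, 0, 1] (by decide),
      Projectivization.mk (ZMod 5) ![1, 1, 1] (by decide),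
      Projectivization.mk (ZMod 5) ![1, 0, 1] (by decide),
      Projectivization.mk (ZMod 5) ![1, 1, 0] (by decide),
      Projectivization.mk (ZMod 5) ![0, 1, 1] (by decide)} : Set (P2 (ZMod 5))) := by
  rw [← range_binaryPoint]
  exact ⟨ncard_range_binaryPoint, isGenArc_range_binaryPoint⟩
end
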